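/- Let K = u/v be shift-reduced with K ≠ 1, let p₁ ∈ F[y], and let m be a natural number. Then there exists q₁ ∈ W_K such that p₁ / (∏_{i=0}^{m} σ^i(v)) − q₁/v belongs to V_K. -/

import Mathlib

open Polynomial

noncomputable def pshift (F : Type*) [Field F] (i : ℤ) :
    Polynomial F →ₐ[F] Polynomial F :=
  aeval (X + C (i : F))

noncomputable def rshift (F : Type*) [Field F] (i : ℤ) : RatFunc F → RatFunc F :=
  fun f => RatFunc.mk (pshift F i f.num) (pshift F i f.denom)

def shiftFree {F : Type*} [Field F] (p : Polynomial F) : Prop :=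
  p ≠ 0 ∧ ∀ i : ℤ, i ≠ 0 → IsCoprime p (pshift F i p)

def shiftReducedPair {F : Type*} [Field F] (u v : Polynomial F) : Prop :=
  u ≠ 0 ∧ v ≠ 0 ∧ IsCoprime u v ∧ ∀ i : ℤ, IsCoprime u (pshift F i v)

def stronglyPrime {F : Type*} [Field F] (p u v : Polynomial F) : Prop :=
  p ≠ 0 ∧ ∀ i : ℕ, IsCoprime p (pshift F (-(i : ℤ)) u) ∧ IsCoprime p (pshift F (i : ℤ) v)

noncomputable def phiK {F : Type*} [Field F] (u v : Polynomial F) :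
    Polynomial F → Polynomial F :=
  fun p => u * pshift F 1 p - v * p

noncomputable def WK (F : Type*) [Field F] (u v : Polynomial F) :
    Submodule F (Polynomial F) :=
  Submodule.span F {q : Polynomial F | ∃ ℓ : ℕ, q = X ^ ℓ ∧
    ∀ w : Polynomial F, w ∈ Set.range (phiK u v) → w ≠ 0 → ℓ ≠ w.natDegree}

def VK {F : Type*} [Field F] (K : RatFunc F) : Set (RatFunc F) :=
  {g | ∃ r : RatFunc F, g = K * rshift F 1 r - r}

def residualForm {F : Type*} [Field F] (u v : Polynomial F) (r : RatFunc F) : Prop :=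
  ∃ a b q : Polynomial F, a.degree < b.degree ∧ shiftFree b ∧ stronglyPrime b u v ∧
    q ∈ WK F u v ∧ r = RatFunc.mk a b + RatFunc.mk q v

section ShiftReduction

variable {F : Type*} [Field F]

theorem pshift_eq_taylor (i : ℤ) (p : F[X]) : pshift F i p = taylor (i : F) p := by
  rw [pshift, taylor_apply]
  rfl

theorem pshift_pshift (i j : ℤ) (p : F[X]) :
    pshift F i (pshift F j p) = pshift F (i + j) p := by
  simp only [pshift_eq_taylor, taylor_taylor, Int.cast_add]

theorem pshift_zero_apply (p : F[X]) : pshift F 0 p = p := by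
  simp [pshift_eq_taylor]

theorem pshift_ne_zero (i : ℤ) {p : F[X]} (hp : p ≠ 0) : pshift F i p ≠ 0 := by
  rw [pshift_eq_taylor]
  exact fun h => hp (taylor_injective (i : F) (by rw [h, map_zero]))

theorem rshift_mk (i : ℤ) (a : F[X]) {b : F[X]} (hb : b ≠ 0) :
    rshift F i (RatFunc.mk a b) = RatFunc.mk (pshift F i a) (pshift F i b) := by
  have hd := RatFunc.denom_ne_zero (RatFunc.mk a b)
  have h : RatFunc.mk (RatFunc.mk a b).num (RatFunc.mk a b).denom = RatFunc.mk a b := by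
    rw [RatFunc.mk_eq_div]
    exact RatFunc.num_div_denom _
  rw [RatFunc.mk_eq_mk hd hb] at h
  rw [rshift, RatFunc.mk_eq_mk (pshift_ne_zero i hd) (pshift_ne_zero i hb), ← map_mul, h,
    map_mul]

theorem rshift_add (i : ℤ) (r s : RatFunc F) :
    rshift F i (r + s) = rshift F i r + rshift F i s := by
  induction r using RatFunc.induction_on' with
  | _ a b hb =>
  induction s using RatFunc.induction_on' with
  | _ c d hd =>
  have key : ∀ {a b c d : F[X]}, b ≠ 0 → d ≠ 0 →
      RatFunc.mk a b + RatFunc.mk c d = RatFunc.mk (a * d + b * c) (b * d) := by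
    intro a b c d hb hd
    have hb' := RatFunc.algebraMap_ne_zero hb
    have hd' := RatFunc.algebraMap_ne_zero hd
    simp only [RatFunc.mk_eq_div, map_add, map_mul]
    exact div_add_div _ _ hb' hd'
  rw [key hb hd, rshift_mk i _ (mul_ne_zero hb hd), rshift_mk i _ hb, rshift_mk i _ hd,
    key (pshift_ne_zero i hb) (pshift_ne_zero i hd)]
  simp only [map_add, map_mul]

theorem add_mem_VK {K f g : RatFunc F} (hf : f ∈ VK K) (hg : g ∈ VK K) : f + g ∈ VK K := by
  obtain ⟨r, rfl⟩ := hf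
  obtain ⟨s, rfl⟩ := hg
  exact ⟨r + s, by rw [rshift_add]; ring⟩

theorem phiK_C_mul (u v : F[X]) (c : F) (p : F[X]) :
    phiK u v (C c * p) = C c * phiK u v p := by
  have h : pshift F 1 (C c) = C c := by simp [pshift_eq_taylor]
  simp only [phiK, map_mul, h]
  ring

theorem phiK_add (u v p q : F[X]) : phiK u v (p + q) = phiK u v p + phiK u v q := by
  simp only [phiK, map_add]
  ring

/-- The image of `phiK u v` and `WK F u v` together span all polynomials. -/
theorem exists_eq_phiK_add_mem_WK (u v p : F[X]) :
    ∃ s, ∃ q ∈ WK F u v, p = phiK u v s + q := by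
  induction hn : p.degree using WellFoundedLT.induction generalizing p with
  | _ n ih =>
  subst hn
  by_cases hp : p = 0
  · exact ⟨0, 0, zero_mem _, by simp [phiK, hp]⟩
  by_cases h : ∃ t, phiK u v t ≠ 0 ∧ p.natDegree = (phiK u v t).natDegree
  · obtain ⟨t, ht, hdeg⟩ := h
    set c := p.leadingCoeff / (phiK u v t).leadingCoeff with hc
    have hc0 : c ≠ 0 := div_ne_zero (leadingCoeff_ne_zero.2 hp) (leadingCoeff_ne_zero.2 ht)
    have hlt : (p - C c * phiK u v t).degree < p.degree := by
      refine degree_sub_lt_left ?_ hp ?_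
      · rw [degree_C_mul hc0, degree_eq_natDegree hp, degree_eq_natDegree ht, hdeg]
      · rw [leadingCoeff_mul, leadingCoeff_C, hc,
          div_mul_cancel₀ _ (leadingCoeff_ne_zero.2 ht)]
    obtain ⟨s, q, hq, hs⟩ := ih _ hlt _ rfl
    refine ⟨s + C c * t, q, hq, ?_⟩
    rw [phiK_add, phiK_C_mul]
    linear_combination hs
  · have hX : (X ^ p.natDegree : F[X]) ∈ WK F u v := by
      refine Submodule.subset_span ⟨_, rfl, ?_⟩
      rintro _ ⟨t, rfl⟩ ht hdeg
      exact h ⟨t, ht, hdeg⟩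
    obtain ⟨s, q, hq, hs⟩ := ih _ (degree_sub_lt_left (q := C p.leadingCoeff * X ^ p.natDegree)
      (by rw [degree_C_mul_X_pow _ (leadingCoeff_ne_zero.2 hp), degree_eq_natDegree hp]) hp
      (by simp)) _ rfl
    refine ⟨s, q + p.leadingCoeff • X ^ p.natDegree,
      add_mem hq (Submodule.smul_mem _ _ hX), ?_⟩
    rw [smul_eq_C_mul]
    linear_combination hs

theorem mk_phiK_mem_VK (u : F[X]) {v : F[X]} (hv : v ≠ 0) (s : F[X]) :
    RatFunc.mk (phiK u v s) v ∈ VK (RatFunc.mk u v) := by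
  have hv' := RatFunc.algebraMap_ne_zero hv
  refine ⟨RatFunc.mk s 1, ?_⟩
  rw [rshift_mk 1 s one_ne_zero]
  simp only [RatFunc.mk_eq_div, phiK, map_sub, map_mul, map_one]
  field_simp

theorem shiftProd_ne_zero {v : F[X]} (hv : v ≠ 0) (m : ℕ) :
    ∏ i ∈ Finset.range m, pshift F (i : ℤ) v ≠ 0 :=
  Finset.prod_ne_zero_iff.2 fun i _ => pshift_ne_zero i hv

theorem mul_pshift_shiftProd (v : F[X]) (m : ℕ) :
    v * pshift F 1 (∏ i ∈ Finset.range m, pshift F (i : ℤ) v) =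
      ∏ i ∈ Finset.range (m + 1), pshift F (i : ℤ) v := by
  rw [Finset.prod_range_succ', map_prod, mul_comm]
  congr 1
  · refine Finset.prod_congr rfl fun i _ => ?_
    rw [pshift_pshift]
    push_cast
    rw [add_comm]
  · exact (pshift_zero_apply v).symm

/-- Modulo `VK`, the last factor of the denominator `∏ i, pshift F i v` can be removed. -/
theorem exists_mk_shiftProd_sub_mem_VK {u v : F[X]} (hv : v ≠ 0) (m : ℕ)
    (huv : IsCoprime u (pshift F m v)) (p : F[X]) :
    ∃ q : F[X], RatFunc.mk p (∏ i ∈ Finset.range (m + 1), pshift F (i : ℤ) v) -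
      RatFunc.mk q (∏ i ∈ Finset.range m, pshift F (i : ℤ) v) ∈ VK (RatFunc.mk u v) := by
  obtain ⟨a, b, hab⟩ := huv
  have hs : pshift F 1 (pshift F (-1) (p * a)) = p * a := by
    rw [pshift_pshift, add_neg_cancel, pshift_zero_apply]
  set s := pshift F (-1) (p * a)
  have hQ := shiftProd_ne_zero hv m
  have hprod := mul_pshift_shiftProd v m
  rw [Finset.prod_range_succ] at hprod ⊢
  set Q := ∏ i ∈ Finset.range m, pshift F (i : ℤ) v
  have hv' := RatFunc.algebraMap_ne_zero hv
  have hQ' := RatFunc.algebraMap_ne_zero hQ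
  have hw' := RatFunc.algebraMap_ne_zero (pshift_ne_zero m hv)
  refine ⟨p * b + s, RatFunc.mk s Q, ?_⟩
  rw [rshift_mk 1 s hQ, hs]
  have hK : RatFunc.mk u v * RatFunc.mk (p * a) (pshift F 1 Q) =
      RatFunc.mk (u * (p * a)) (Q * pshift F m v) := by
    rw [← hprod]
    simp only [RatFunc.mk_eq_div, map_mul]
    exact div_mul_div_comm _ _ _ _
  rw [hK]
  have hp : p = u * (p * a) + p * b * pshift F m v := by linear_combination -p * hab
  have hp' := congrArg (algebraMap F[X] (RatFunc F)) hp
  simp only [map_add, map_mul] at hp'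
  simp only [RatFunc.mk_eq_div, map_add, map_mul]
  field_simp
  linear_combination hp'

end ShiftReduction

/-- p₁ / ∏_{i=0}^{m} σ^i(v) is congruent modulo V_K to q₁/v for some
q₁ ∈ W_K. -/
theorem stmt14 {F : Type*} [Field F] [CharZero F] (u v p₁ : Polynomial F) (m : ℕ)
    (hsr : shiftReducedPair u v) (hK1 : RatFunc.mk u v ≠ 1) :
    ∃ q₁ ∈ WK F u v,
      RatFunc.mk p₁ (∏ i ∈ Finset.range (m + 1), pshift F (i : ℤ) v) - RatFunc.mk q₁ v
        ∈ VK (RatFunc.mk u v) := by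
  obtain ⟨-, hv, -, hcop⟩ := hsr
  induction m generalizing p₁ with
  | zero =>
    obtain ⟨s, q, hq, rfl⟩ := exists_eq_phiK_add_mem_WK u v p₁
    refine ⟨q, hq, ?_⟩
    have h := mk_phiK_mem_VK u hv s
    simpa [pshift_zero_apply, RatFunc.mk_eq_div, add_div] using h
  | succ m ih =>
    obtain ⟨p₂, hp₂⟩ := exists_mk_shiftProd_sub_mem_VK hv (m + 1) (hcop _) p₁
    obtain ⟨q, hq, hq'⟩ := ih p₂
    exact ⟨q, hq, by simpa using add_mem_VK hp₂ hq'⟩
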